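/- Let m ≥ 2 be an integer and h > 0. For every integer k with 2m+1 ≤ k ≤ 4m the series ∑_{β∈ℤ} D_m[β]·(hβ)^k converges absolutely, and ∑_{β∈ℤ} D_m[β]·(hβ)^k = 0 for 2m+1 ≤ k ≤ 4m−1, while ∑_{β∈ℤ} D_m[β]·(hβ)^{4m} = h^{2m}·(4m)!·B_{2m}/(2m)!, where B_{2m} is the 2m-th Bernoulli number (with the convention B_2 = 1/6, B_4 = −1/30). -/

import Mathlib

/-- The Euler–Frobenius coefficient `a_s^{(k)}`. -/
noncomputable def eulerCoeff (k s : ℕ) : ℝ :=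
  ∑ j ∈ Finset.range (s + 1),
    (-1 : ℝ) ^ j * (Nat.choose (k + 2) j : ℝ) * ((s + 1 - j : ℕ) : ℝ) ^ (k + 1)

/-- The Euler–Frobenius polynomial `E_k`. -/
noncomputable def eulerPoly (k : ℕ) : Polynomial ℝ :=
  ∑ s ∈ Finset.range (k + 1), Polynomial.C (eulerCoeff k s) * Polynomial.X ^ s

/-- The set `Λ` of real roots of `E_{2m-2}` of modulus less than `1`. -/
noncomputable def smallRoots (m : ℕ) : Finset ℝ :=
  (eulerPoly (2 * m - 2)).roots.toFinset.filter (fun x => |x| < 1)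

/-- The discrete analogue `D_m[β]` of the operator `d^{2m}/dx^{2m}`. -/
noncomputable def Dm (m : ℕ) (h : ℝ) (β : ℤ) : ℝ :=
  (((2 * m - 1).factorial : ℝ) / h ^ (2 * m)) *
    (if β = 0 then
      -(2 : ℝ) ^ (2 * m - 1) +
        ∑ l ∈ smallRoots m, (1 - l) ^ (2 * m + 1) / (l * (eulerPoly (2 * m - 1)).eval l)
    else if β.natAbs = 1 then
      1 + ∑ l ∈ smallRoots m, (1 - l) ^ (2 * m + 1) / (eulerPoly (2 * m - 1)).eval l
    else
      ∑ l ∈ smallRoots m,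
        (1 - l) ^ (2 * m + 1) * l ^ β.natAbs / (l * (eulerPoly (2 * m - 1)).eval l))

section EulerFrobenius

open Polynomial

/-- The Euler–Frobenius polynomials, built by their differential recurrence. -/
noncomputable def eulerRec : ℕ → ℝ[X]
  | 0 => 1
  | k + 1 => (1 + C ((k : ℝ) + 1) * X) * eulerRec k + X * (1 - X) * derivative (eulerRec k)

theorem coe_eulerRec (k : ℕ) :
    (eulerRec k : PowerSeries ℝ) =
      (1 - PowerSeries.X) ^ (k + 2) * PowerSeries.mk fun i => ((i : ℝ) + 1) ^ (k + 1) := by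
  induction k with
  | zero =>
    simp only [eulerRec, Polynomial.coe_one, zero_add, pow_one]
    ext n
    have h (f : PowerSeries ℝ) : (1 - PowerSeries.X) ^ 2 * f
        = f - PowerSeries.X * f - PowerSeries.X * (f - PowerSeries.X * f) := by ring
    rw [h]
    rcases n with _ | _ | n <;>
      simp [PowerSeries.coeff_succ_X_mul, PowerSeries.coeff_one]
  | succ k ih =>
    set F : PowerSeries ℝ := PowerSeries.mk fun i => ((i : ℝ) + 1) ^ (k + 1) with hF
    have hstep : (PowerSeries.mk fun i => ((i : ℝ) + 1) ^ (k + 1 + 1) : PowerSeries ℝ)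
        = F + PowerSeries.X * PowerSeries.derivative ℝ F := by
      ext n
      rcases n with _ | n
      · simp [hF]
      · simp [hF, PowerSeries.coeff_succ_X_mul, PowerSeries.coeff_derivative]
        ring
    have hd : ((derivative (eulerRec k) : ℝ[X]) : PowerSeries ℝ) =
        -((k : PowerSeries ℝ) + 2) * (1 - PowerSeries.X) ^ (k + 1) * F
          + (1 - PowerSeries.X) ^ (k + 2) * PowerSeries.derivative ℝ F := by
      rw [← PowerSeries.derivative_coe, ih, Derivation.leibniz, Derivation.leibniz_pow]
      simp
      ring
    rw [hstep, eulerRec]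
    push_cast
    rw [hd, ih]
    simp only [map_add, map_natCast, map_one]
    ring

theorem coeff_eulerRec (k s : ℕ) : (eulerRec k).coeff s = eulerCoeff k s := by
  have h : ((1 - PowerSeries.X : PowerSeries ℝ)) ^ (k + 2) =
      PowerSeries.mk fun j => (-1 : ℝ) ^ j * ((k + 2).choose j : ℝ) := by
    have : ((1 - PowerSeries.X : PowerSeries ℝ)) ^ (k + 2) =
        (((1 + C (-1) * X) ^ (k + 2) : ℝ[X]) : PowerSeries ℝ) := by
      push_cast
      simp [sub_eq_add_neg]
    rw [this]
    ext j
    have e : (1 + C (-1) * X : ℝ[X]) ^ (k + 2) = ((1 + X : ℝ[X]) ^ (k + 2)).comp (C (-1) * X) := by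
      simp
    rw [Polynomial.coeff_coe, e, comp_C_mul_X_coeff, coeff_one_add_X_pow]
    simp [mul_comm]
  rw [← Polynomial.coeff_coe, coe_eulerRec, h, PowerSeries.coeff_mul,
    Finset.Nat.sum_antidiagonal_eq_sum_range_succ_mk, eulerCoeff]
  refine Finset.sum_congr rfl fun j hj => ?_
  have hj' : j ≤ s := Nat.lt_succ_iff.mp (Finset.mem_range.mp hj)
  simp only [PowerSeries.coeff_mk]
  rw [Nat.sub_add_comm hj']
  push_cast
  rfl

theorem natDegree_eulerRec_le (k : ℕ) : (eulerRec k).natDegree ≤ k := by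
  induction k with
  | zero => simp [eulerRec]
  | succ k ih =>
    rw [natDegree_le_iff_coeff_eq_zero] at ih ⊢
    intro n hn
    obtain ⟨n, rfl⟩ : ∃ j, n = j + 2 := ⟨n - 2, by omega⟩
    have e : eulerRec (k + 1) = eulerRec k + C ((k : ℝ) + 1) * (X * eulerRec k)
        + X * derivative (eulerRec k) - X * (X * derivative (eulerRec k)) := by
      rw [eulerRec]; ring
    rw [e]
    simp only [coeff_add, coeff_sub, coeff_C_mul, coeff_X_mul, coeff_derivative]
    rw [ih (n + 2) (by omega)]
    rcases Nat.lt_or_ge k (n + 1) with h | h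
    · rw [ih (n + 1) h]; simp
    · omega

theorem eulerPoly_eq_eulerRec (k : ℕ) : eulerPoly k = eulerRec k := by
  rw [(eulerRec k).as_sum_range_C_mul_X_pow' (Nat.lt_succ_of_le (natDegree_eulerRec_le k)),
    eulerPoly]
  simp [coeff_eulerRec]

theorem eulerPoly_zero : eulerPoly 0 = 1 := by
  rw [eulerPoly_eq_eulerRec, eulerRec]

theorem eulerPoly_succ (k : ℕ) :
    eulerPoly (k + 1) =
      (1 + C ((k : ℝ) + 1) * X) * eulerPoly k + X * (1 - X) * derivative (eulerPoly k) := by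
  simp only [eulerPoly_eq_eulerRec, eulerRec]

theorem natDegree_eulerPoly_le (k : ℕ) : (eulerPoly k).natDegree ≤ k :=
  eulerPoly_eq_eulerRec k ▸ natDegree_eulerRec_le k

theorem eulerPoly_succ' (k : ℕ) :
    eulerPoly (k + 1) = eulerPoly k + C ((k : ℝ) + 1) * (X * eulerPoly k)
      + X * derivative (eulerPoly k) - X * (X * derivative (eulerPoly k)) := by
  rw [eulerPoly_succ]; ring

theorem coeff_zero_eulerPoly (k : ℕ) : (eulerPoly k).coeff 0 = 1 := by
  induction k with
  | zero => simp [eulerPoly_zero]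
  | succ k ih => simp [eulerPoly_succ', ih]

theorem coeff_self_eulerPoly (k : ℕ) : (eulerPoly k).coeff k = 1 := by
  induction k with
  | zero => simp [eulerPoly_zero]
  | succ k ih =>
    have h := coeff_eq_zero_of_natDegree_lt (Nat.lt_succ_of_le (natDegree_eulerPoly_le k))
    rw [eulerPoly_succ']
    simp only [coeff_add, coeff_sub, coeff_C_mul, coeff_X_mul, coeff_derivative, ih, h]
    rcases k with _ | k
    · simp
    · simp only [coeff_X_mul, coeff_derivative, ih]
      push_cast
      ring

theorem coeff_pred_eulerPoly (k : ℕ) :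
    (eulerPoly (k + 1)).coeff k = 2 ^ (k + 2) - (k + 3) := by
  induction k with
  | zero => norm_num [coeff_zero_eulerPoly]
  | succ k ih =>
    have h := coeff_self_eulerPoly (k + 1)
    rw [eulerPoly_succ']
    simp only [coeff_add, coeff_sub, coeff_C_mul, coeff_X_mul, coeff_derivative, ih, h]
    rcases k with _ | k
    · norm_num
    · simp only [coeff_X_mul, coeff_derivative, ih]
      push_cast
      ring

theorem eval_one_eulerPoly (k : ℕ) : (eulerPoly k).eval 1 = (k + 1).factorial := by
  induction k with
  | zero => simp [eulerPoly_zero]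
  | succ k ih =>
    rw [eulerPoly_succ, Nat.factorial_succ (k + 1)]
    push_cast
    simp only [eval_add, eval_mul, eval_one, eval_C, eval_X, eval_sub, ih]
    ring

theorem eulerPoly_ne_zero (k : ℕ) : eulerPoly k ≠ 0 := fun h => by
  simpa [h] using coeff_zero_eulerPoly k

/-- The polynomial `R` with `R (1 / (1 - z)) = (z d/dz)^n (1 / (1 - z))`. -/
noncomputable def logisticPoly : ℕ → ℝ[X]
  | 0 => X
  | n + 1 => X * (X - 1) * derivative (logisticPoly n)

theorem logisticPoly_ne_zero_and_card (n : ℕ) : logisticPoly (n + 1) ≠ 0 ∧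
    (logisticPoly (n + 1)).IsRoot 0 ∧ (logisticPoly (n + 1)).IsRoot 1 ∧
    n + 2 ≤ (logisticPoly (n + 1)).roots.toFinset.card := by
  have hX1 : (X - 1 : ℝ[X]) ≠ 0 := by simpa using X_sub_C_ne_zero (1 : ℝ)
  induction n with
  | zero =>
    have e : logisticPoly (0 + 1) = X * (X - 1) := by simp [logisticPoly]
    have h0 : (X * (X - 1) : ℝ[X]) ≠ 0 := mul_ne_zero X_ne_zero hX1
    rw [e]
    refine ⟨h0, by simp, by simp, ?_⟩
    have : ({0, 1} : Finset ℝ) ⊆ (X * (X - 1) : ℝ[X]).roots.toFinset := by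
      intro x hx
      rw [Multiset.mem_toFinset, mem_roots h0]
      rcases Finset.mem_insert.mp hx with rfl | hx
      · simp
      · rw [Finset.mem_singleton.mp hx]; simp
    simpa using Finset.card_le_card this
  | succ n ih =>
    obtain ⟨h0, hr0, hr1, hc⟩ := ih
    set p := logisticPoly (n + 1)
    have hd := card_roots_toFinset_le_card_roots_derivative_sdiff_roots_succ p
    have hd0 : derivative p ≠ 0 := by
      intro h
      simp [h] at hd
      omega
    have e : logisticPoly (n + 1 + 1) = X * (X - 1) * derivative p := rfl
    have hq : X * (X - 1) * derivative p ≠ 0 := mul_ne_zero (mul_ne_zero X_ne_zero hX1) hd0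
    rw [e]
    refine ⟨hq, by simp, by simp, ?_⟩
    set S := (derivative p).roots.toFinset \ p.roots.toFinset
    have m0 : (0 : ℝ) ∉ S := by
      simp [S, h0, hr0.eq_zero]
    have m1 : (1 : ℝ) ∉ S := by
      simp [S, h0, hr1.eq_zero]
    have hsub : insert 0 (insert 1 S) ⊆ (X * (X - 1) * derivative p).roots.toFinset := by
      intro x hx
      rw [Multiset.mem_toFinset, mem_roots hq]
      rcases Finset.mem_insert.mp hx with rfl | hx
      · simp
      · rcases Finset.mem_insert.mp hx with rfl | hx
        · simp
        · have := (Finset.mem_sdiff.mp hx).1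
          rw [Multiset.mem_toFinset, mem_roots hd0] at this
          simp [this.eq_zero]
    have := Finset.card_le_card hsub
    rw [Finset.card_insert_of_notMem (by simp [m0]), Finset.card_insert_of_notMem m1] at this
    omega

theorem logisticPoly_comp_one_sub (n : ℕ) :
    (logisticPoly (n + 1)).comp (1 - X) = (-1) ^ n * logisticPoly (n + 1) := by
  induction n with
  | zero => simp [logisticPoly]; ring
  | succ n ih =>
    have h := congrArg derivative ih
    rw [derivative_comp] at h
    rw [logisticPoly]
    set p := logisticPoly (n + 1)
    have h2 : derivative ((-1) ^ n * p) = (-1) ^ n * derivative p := by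
      rw [show ((-1) ^ n * p : ℝ[X]) = C ((-1) ^ n) * p by simp, derivative_C_mul]
      simp
    rw [h2] at h
    simp only [derivative_sub, derivative_one, derivative_X] at h
    simp only [mul_comp, sub_comp, X_comp, one_comp]
    linear_combination X * (X - 1) * (-1 : ℝ[X]) * h

theorem mul_eval_eulerPoly (n : ℕ) {z : ℝ} (hz : z ≠ 1) :
    z * (eulerPoly n).eval z = (1 - z) ^ (n + 2) * (logisticPoly (n + 1)).eval (1 / (1 - z)) := by
  induction n generalizing z with
  | zero =>
    have : 1 - z ≠ 0 := sub_ne_zero.mpr hz.symm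
    simp [eulerPoly_zero, logisticPoly]
    field_simp
    ring
  | succ n ih =>
    have h1 : 1 - z ≠ 0 := sub_ne_zero.mpr hz.symm
    have hw : HasDerivAt (fun z : ℝ => 1 / (1 - z)) (1 / (1 - z) ^ 2) z := by
      have := ((hasDerivAt_id z).const_sub 1).fun_inv h1
      simpa [one_div] using this
    have hL : HasDerivAt (fun z : ℝ => z * (eulerPoly n).eval z)
        (1 * (eulerPoly n).eval z + z * (derivative (eulerPoly n)).eval z) z :=
      (hasDerivAt_id z).mul ((eulerPoly n).hasDerivAt z)
    have hR := (((hasDerivAt_id z).const_sub 1).pow (n + 2)).mul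
      (((logisticPoly (n + 1)).hasDerivAt (1 / (1 - z))).comp z hw)
    have heq : (fun z : ℝ => z * (eulerPoly n).eval z) =ᶠ[nhds z]
        fun z => (1 - z) ^ (n + 2) * (logisticPoly (n + 1)).eval (1 / (1 - z)) := by
      filter_upwards [isOpen_ne.mem_nhds hz] with x hx using ih hx
    have hu := hL.unique (hR.congr_of_eventuallyEq heq)
    have ihz := ih hz
    rw [eulerPoly_succ, logisticPoly]
    simp at hu ihz ⊢
    field_simp at hu ihz ⊢
    linear_combination z * (1 - z) * hu + ((n : ℝ) + 2) * z * (1 - z) ^ 2 * ihz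

end EulerFrobenius

section EulerFrobeniusRoots

open Polynomial

theorem eval_inv_eulerPoly (n : ℕ) {x : ℝ} (hx : x ≠ 0) :
    x ^ n * (eulerPoly n).eval x⁻¹ = (eulerPoly n).eval x := by
  rcases eq_or_ne x 1 with rfl | hx1
  · simp
  have h1 : 1 - x ≠ 0 := sub_ne_zero.mpr hx1.symm
  have h1' : x - 1 ≠ 0 := sub_ne_zero.mpr hx1
  have hi : x⁻¹ ≠ 1 := by simpa using hx1
  have hs := congrArg (eval (1 / (1 - x))) (logisticPoly_comp_one_sub n)
  have ha := mul_eval_eulerPoly n hx1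
  have hb := mul_eval_eulerPoly n hi
  have hw : 1 / (1 - x⁻¹) = 1 - 1 / (1 - x) := by
    have : 1 - x⁻¹ ≠ 0 := sub_ne_zero.mpr hi.symm
    field_simp
    ring
  have hy : (1 - x⁻¹) = -((1 - x) * x⁻¹) := by field_simp; ring
  simp only [eval_comp, eval_sub, eval_one, eval_X, eval_mul, eval_pow, eval_neg] at hs
  rw [hw, hs, hy, neg_pow, mul_pow] at hb
  have hsgn : ((-1 : ℝ) ^ (n + 2)) * (-1) ^ n = 1 := by
    rw [← pow_add, show n + 2 + n = 2 * (n + 1) by ring, pow_mul]; simp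
  have hb' : x⁻¹ * (eulerPoly n).eval x⁻¹ = x⁻¹ ^ (n + 2) * (x * (eulerPoly n).eval x) := by
    rw [ha, hb]
    linear_combination ((1 - x) ^ (n + 2) * x⁻¹ ^ (n + 2) *
      (logisticPoly (n + 1)).eval (1 / (1 - x))) * hsgn
  have hxn : x ^ (n + 1) * x⁻¹ ^ (n + 1) = 1 := by
    rw [← mul_pow, mul_inv_cancel₀ hx, one_pow]
  have hxx : x * x⁻¹ = 1 := mul_inv_cancel₀ hx
  calc x ^ n * (eulerPoly n).eval x⁻¹
      = x ^ (n + 1) * (x⁻¹ * (eulerPoly n).eval x⁻¹) := by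
        rw [pow_succ]; linear_combination (-(x ^ n * (eulerPoly n).eval x⁻¹)) * hxx
    _ = (x ^ (n + 1) * x⁻¹ ^ (n + 1)) * (x * x⁻¹) * (eulerPoly n).eval x := by
        rw [hb']; ring
    _ = _ := by rw [hxn, hxx]; ring

theorem le_card_roots_eulerPoly (n : ℕ) : n ≤ (eulerPoly n).roots.toFinset.card := by
  obtain ⟨h0, -, -, hc⟩ := logisticPoly_ne_zero_and_card n
  set S := ((logisticPoly (n + 1)).roots.toFinset.erase 0).erase 1
  have hS : n ≤ S.card := by
    have h1 := Finset.pred_card_le_card_erase (s := (logisticPoly (n + 1)).roots.toFinset) (a := 0)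
    have h2 : _ ≤ S.card := Finset.pred_card_le_card_erase
      (s := (logisticPoly (n + 1)).roots.toFinset.erase 0) (a := 1)
    omega
  refine hS.trans (Finset.card_le_card_of_injOn (fun w => 1 - 1 / w) ?_ ?_)
  · intro w hw
    simp only [S, Finset.mem_coe, Finset.mem_erase, Multiset.mem_toFinset, mem_roots h0] at hw
    obtain ⟨hw1, hw0, hr⟩ := hw
    have hz : 1 - 1 / w ≠ 1 := by simp [hw0]
    have h := mul_eval_eulerPoly n hz
    have e : 1 / (1 - (1 - 1 / w)) = w := by simp
    rw [e, hr.eq_zero, mul_zero, mul_eq_zero] at h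
    simp only [Finset.mem_coe, Multiset.mem_toFinset, mem_roots (eulerPoly_ne_zero n)]
    refine h.resolve_left fun h => hw1 ?_
    field_simp at h
    linarith
  · intro a _ b _ hab
    simpa using hab

theorem card_roots_eulerPoly (n : ℕ) :
    (eulerPoly n).roots.card ≤ (eulerPoly n).roots.toFinset.card :=
  ((card_roots' _).trans (natDegree_eulerPoly_le n)).trans (le_card_roots_eulerPoly n)

theorem eval_derivative_eulerPoly_ne_zero {n : ℕ} {x : ℝ} (hx : (eulerPoly n).IsRoot x) :
    (derivative (eulerPoly n)).eval x ≠ 0 := by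
  intro h
  have hnd : (eulerPoly n).roots.Nodup := by
    rw [← Multiset.toFinset_card_eq_card_iff_nodup]
    exact le_antisymm (Multiset.toFinset_card_le _) (card_roots_eulerPoly n)
  have h1 := (one_lt_rootMultiplicity_iff_isRoot (eulerPoly_ne_zero n)).mpr ⟨hx, h⟩
  rw [← count_roots] at h1
  exact absurd (Multiset.nodup_iff_count_le_one.mp hnd x) (by omega)

theorem root_eulerPoly_ne_zero {n : ℕ} {x : ℝ} (hx : (eulerPoly n).IsRoot x) : x ≠ 0 := by
  rintro rfl
  have h := coeff_zero_eulerPoly n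
  rw [coeff_zero_eq_eval_zero, hx.eq_zero] at h
  exact zero_ne_one h

theorem root_eulerPoly_ne_one {n : ℕ} {x : ℝ} (hx : (eulerPoly n).IsRoot x) : x ≠ 1 := by
  rintro rfl
  have h := eval_one_eulerPoly n
  rw [hx.eq_zero] at h
  exact (Nat.cast_ne_zero.mpr (Nat.factorial_ne_zero _)) h.symm

theorem isRoot_inv_eulerPoly {n : ℕ} {x : ℝ} (hx : (eulerPoly n).IsRoot x) :
    (eulerPoly n).IsRoot x⁻¹ := by
  have h0 := root_eulerPoly_ne_zero hx
  have h := eval_inv_eulerPoly n h0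
  rw [hx.eq_zero] at h
  exact (mul_eq_zero.mp h).resolve_left (pow_ne_zero _ h0)

theorem eval_derivative_inv_eulerPoly {n : ℕ} {x : ℝ} (hx : (eulerPoly n).IsRoot x) :
    x ^ n * (derivative (eulerPoly n)).eval x⁻¹ = -x ^ 2 * (derivative (eulerPoly n)).eval x := by
  have h0 := root_eulerPoly_ne_zero hx
  have hL := (hasDerivAt_pow n x).mul
    (((eulerPoly n).hasDerivAt x⁻¹).comp x (hasDerivAt_inv h0))
  have heq : (eulerPoly n).eval =ᶠ[nhds x] fun y => y ^ n * (eulerPoly n).eval y⁻¹ := by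
    filter_upwards [isOpen_ne.mem_nhds h0] with y hy using (eval_inv_eulerPoly n hy).symm
  have h := (hL.congr_of_eventuallyEq heq).unique ((eulerPoly n).hasDerivAt x)
  simp only [Function.comp_apply, (isRoot_inv_eulerPoly hx).eq_zero] at h
  rw [← h]
  field_simp
  ring

theorem eval_neg_one_eulerPoly_ne_zero {n : ℕ} (hn : Even n) : ¬ (eulerPoly n).IsRoot (-1) := by
  intro hx
  have h := eval_derivative_inv_eulerPoly hx
  have h' := eval_derivative_eulerPoly_ne_zero hx
  rw [hn.neg_one_pow] at h
  norm_num [inv_neg] at h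
  apply h'
  linarith

theorem abs_root_eulerPoly_ne_one {n : ℕ} (hn : Even n) {x : ℝ} (hx : (eulerPoly n).IsRoot x) :
    |x| ≠ 1 := by
  intro h
  rcases eq_or_eq_neg_of_abs_eq h with rfl | rfl
  · exact root_eulerPoly_ne_one hx rfl
  · exact eval_neg_one_eulerPoly_ne_zero hn hx

theorem eulerPoly_succ_eval_root {n : ℕ} {x : ℝ} (hx : (eulerPoly n).IsRoot x) :
    (eulerPoly (n + 1)).eval x = x * (1 - x) * (derivative (eulerPoly n)).eval x := by
  simp [eulerPoly_succ, hx.eq_zero]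

/-- The roots of `E_n` in the open unit disk. -/
noncomputable def unitDiskRoots (n : ℕ) : Finset ℝ :=
  (eulerPoly n).roots.toFinset.filter (fun x => |x| < 1)

theorem mem_unitDiskRoots {n : ℕ} {x : ℝ} :
    x ∈ unitDiskRoots n ↔ (eulerPoly n).IsRoot x ∧ |x| < 1 := by
  simp [unitDiskRoots, eulerPoly_ne_zero]

/-- The quotient of `E_n` by the product of the linear factors at `x` and `1 / x`. -/
noncomputable def pairQuotient (n : ℕ) (x : ℝ) : ℝ[X] :=
  eulerPoly n /ₘ ((X - C x) * (X - C x⁻¹))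

theorem ne_inv_of_mem_unitDiskRoots {n : ℕ} {x : ℝ} (hx : x ∈ unitDiskRoots n) : x ≠ x⁻¹ := by
  obtain ⟨hr, ha⟩ := mem_unitDiskRoots.mp hx
  intro h
  have h2 : x * x = 1 := by
    nth_rewrite 2 [h]
    exact mul_inv_cancel₀ (root_eulerPoly_ne_zero hr)
  have : |x| * |x| = 1 := by rw [← abs_mul, h2, abs_one]
  nlinarith [abs_nonneg x]

theorem eulerPoly_eq_mul_pairQuotient {n : ℕ} {x : ℝ} (hx : x ∈ unitDiskRoots n) :
    eulerPoly n = (X - C x) * (X - C x⁻¹) * pairQuotient n x := by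
  have hr := (mem_unitDiskRoots.mp hx).1
  have hm : ((X - C x) * (X - C x⁻¹)).Monic := (monic_X_sub_C x).mul (monic_X_sub_C x⁻¹)
  have hdvd : (X - C x) * (X - C x⁻¹) ∣ eulerPoly n :=
    (isCoprime_X_sub_C_of_isUnit_sub
      (sub_ne_zero.mpr (ne_inv_of_mem_unitDiskRoots hx)).isUnit).mul_dvd
      (dvd_iff_isRoot.mpr hr) (dvd_iff_isRoot.mpr (isRoot_inv_eulerPoly hr))
  have h := modByMonic_add_div (eulerPoly n) ((X - C x) * (X - C x⁻¹))
  rw [(modByMonic_eq_zero_iff_dvd hm).mpr hdvd, zero_add] at h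
  exact h.symm

theorem natDegree_pairQuotient_le (n : ℕ) (x : ℝ) : (pairQuotient n x).natDegree ≤ n - 2 := by
  have hm : ((X - C x) * (X - C x⁻¹)).Monic := (monic_X_sub_C x).mul (monic_X_sub_C x⁻¹)
  have hd : ((X - C x) * (X - C x⁻¹)).natDegree = 2 := by
    rw [(monic_X_sub_C x).natDegree_mul (monic_X_sub_C x⁻¹)]
    simp
  rw [pairQuotient, natDegree_divByMonic _ hm, hd]
  exact Nat.sub_le_sub_right (natDegree_eulerPoly_le n) 2

/-- The coefficient of the partial fraction attached to the roots `x` and `1 / x`. -/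
noncomputable def pairWeight (n : ℕ) (x : ℝ) : ℝ :=
  (1 - x) ^ (n + 3) / (eulerPoly (n + 1)).eval x * (1 - x⁻¹ ^ 2)

theorem eval_pairQuotient_self {n : ℕ} {x : ℝ} (hx : x ∈ unitDiskRoots n) :
    (derivative (eulerPoly n)).eval x = (x - x⁻¹) * (pairQuotient n x).eval x := by
  conv_lhs => rw [eulerPoly_eq_mul_pairQuotient hx]
  simp

theorem eval_pairQuotient_inv {n : ℕ} {x : ℝ} (hx : x ∈ unitDiskRoots n) :
    (derivative (eulerPoly n)).eval x⁻¹ = (x⁻¹ - x) * (pairQuotient n x).eval x⁻¹ := by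
  conv_lhs => rw [eulerPoly_eq_mul_pairQuotient hx]
  simp

theorem eval_pairQuotient_of_ne {n : ℕ} {x y : ℝ} (hx : x ∈ unitDiskRoots n)
    (hy : (eulerPoly n).IsRoot y) (h1 : y ≠ x) (h2 : y ≠ x⁻¹) :
    (pairQuotient n x).eval y = 0 := by
  have h := hy.eq_zero
  rw [eulerPoly_eq_mul_pairQuotient hx] at h
  simpa [sub_eq_zero, h1, h2] using h

theorem pairWeight_mul_eval {n : ℕ} {x : ℝ} (hx : x ∈ unitDiskRoots n) :
    (1 - x) ^ (n + 2) = x ^ 2 * (pairWeight n x * (pairQuotient n x).eval x) := by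
  have hr := (mem_unitDiskRoots.mp hx).1
  have h0 := root_eulerPoly_ne_zero hr
  have h1 : 1 - x ≠ 0 := sub_ne_zero.mpr (root_eulerPoly_ne_one hr).symm
  have hd := eval_derivative_eulerPoly_ne_zero hr
  have hq := eval_pairQuotient_self hx
  have hq0 : (pairQuotient n x).eval x ≠ 0 := fun h => hd (by rw [hq, h, mul_zero])
  have hxx : x - x⁻¹ ≠ 0 := sub_ne_zero.mpr (ne_inv_of_mem_unitDiskRoots hx)
  have e : 1 - x⁻¹ ^ 2 = (x - x⁻¹) * x⁻¹ := by field_simp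
  rw [pairWeight, eulerPoly_succ_eval_root hr, hq, e]
  generalize x - x⁻¹ = u at hxx
  rw [pow_succ _ (n + 2)]
  field_simp

theorem pairWeight_mul_eval_inv {n : ℕ} (hn : Even n) {x : ℝ}
    (hx : x ∈ unitDiskRoots n) :
    (1 - x⁻¹) ^ (n + 2) = x⁻¹ ^ 2 * (pairWeight n x * (pairQuotient n x).eval x⁻¹) := by
  have hr := (mem_unitDiskRoots.mp hx).1
  have h0 := root_eulerPoly_ne_zero hr
  have hxx : x - x⁻¹ ≠ 0 := sub_ne_zero.mpr (ne_inv_of_mem_unitDiskRoots hx)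
  have h := eval_derivative_inv_eulerPoly hr
  rw [eval_pairQuotient_self hx, eval_pairQuotient_inv hx] at h
  have h' : x ^ n * (pairQuotient n x).eval x⁻¹ = x ^ 2 * (pairQuotient n x).eval x := by
    apply mul_left_cancel₀ hxx
    linear_combination -h
  have hw := pairWeight_mul_eval hx
  have hy : (1 - x⁻¹) ^ (n + 2) = (1 - x) ^ (n + 2) / x ^ (n + 2) := by
    rw [show 1 - x⁻¹ = -((1 - x) / x) by field_simp; ring, (hn.add even_two).neg_pow, div_pow]
  rw [hy, hw]
  generalize (pairQuotient n x).eval x⁻¹ = q at h'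
  field_simp
  rw [pow_add]
  linear_combination (-pairWeight n x * x ^ 2) * h'

/-- Partial fraction decomposition of `(1 - X)^(n+2) / (X E_n)`, cleared of denominators. -/
theorem one_sub_pow_eq_partial_fractions {n : ℕ} (hn : Even n) (hn2 : 2 ≤ n) :
    (1 - X : ℝ[X]) ^ (n + 2) = (X ^ 2 - C (2 ^ (n + 1)) * X + 1) * eulerPoly n +
      X ^ 2 * ∑ x ∈ unitDiskRoots n, C (pairWeight n x) * pairQuotient n x := by
  rw [← sub_eq_zero]
  set S := ∑ x ∈ unitDiskRoots n, C (pairWeight n x) * pairQuotient n x with hS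
  set N := (1 - X : ℝ[X]) ^ (n + 2) - ((X ^ 2 - C (2 ^ (n + 1)) * X + 1) * eulerPoly n +
      X ^ 2 * S) with hN
  have hroot : ∀ y, (eulerPoly n).IsRoot y → N.eval y = 0 := by
    intro y hy
    have hy0 := root_eulerPoly_ne_zero hy
    obtain ⟨x, hx, hyx⟩ : ∃ x ∈ unitDiskRoots n, y = x ∨ y = x⁻¹ := by
      rcases lt_or_gt_of_ne (abs_root_eulerPoly_ne_one hn hy) with h | h
      · exact ⟨y, mem_unitDiskRoots.mpr ⟨hy, h⟩, Or.inl rfl⟩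
      · refine ⟨y⁻¹, mem_unitDiskRoots.mpr ⟨isRoot_inv_eulerPoly hy, ?_⟩, Or.inr (by simp)⟩
        rw [abs_inv]
        exact inv_lt_one_of_one_lt₀ h
    have hsum : S.eval y = pairWeight n x * (pairQuotient n x).eval y := by
      rw [hS, eval_finsetSum, Finset.sum_eq_single_of_mem x hx]
      · simp
      · intro z hz hzx
        have hzabs := (mem_unitDiskRoots.mp hz).2
        have hxabs := (mem_unitDiskRoots.mp hx).2
        have hz0 := root_eulerPoly_ne_zero (mem_unitDiskRoots.mp hz).1
        have hne : x ≠ z⁻¹ := by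
          intro h
          have := one_lt_inv_iff₀.mpr ⟨abs_pos.mpr hz0, hzabs⟩
          rw [h, abs_inv] at hxabs
          linarith
        rw [eval_mul, eval_pairQuotient_of_ne hz hy, mul_zero]
        · rcases hyx with rfl | rfl
          · exact hzx.symm
          · intro h
            exact hne (by rw [← h, inv_inv])
        · rcases hyx with rfl | rfl
          · exact hne
          · exact fun h => hzx (inv_injective h).symm
    have hval : (1 - y) ^ (n + 2) = y ^ 2 * (pairWeight n x * (pairQuotient n x).eval y) := by
      rcases hyx with rfl | rfl
      · exact pairWeight_mul_eval hx
      · exact pairWeight_mul_eval_inv hn hx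
    simp [hN, hy.eq_zero, hsum, hval]
  have hzero : N.eval 0 = 0 := by
    have := coeff_zero_eulerPoly n
    rw [coeff_zero_eq_eval_zero] at this
    simp [hN, this]
  have hSdeg : S.natDegree ≤ n - 2 :=
    natDegree_sum_le_of_forall_le _ _ fun x _ =>
      (natDegree_C_mul_le _ _).trans (natDegree_pairQuotient_le n x)
  have hE := natDegree_le_iff_coeff_eq_zero.mp (natDegree_eulerPoly_le n)
  have hpow : (1 - X : ℝ[X]) ^ (n + 2) = (X + C (-1)) ^ (n + 2) := by
    rw [← (hn.add even_two).neg_pow]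
    simp [sub_eq_add_neg, add_comm]
  have hN' : N = (X + C (-1)) ^ (n + 2) - (X * (X * eulerPoly n)
      - C (2 ^ (n + 1)) * (X * eulerPoly n) + eulerPoly n + X * (X * S)) := by
    rw [hN, hpow]; ring
  have hdeg : N.natDegree ≤ n := by
    rw [natDegree_le_iff_coeff_eq_zero]
    intro j hj
    obtain ⟨i, rfl⟩ : ∃ i, j = i + 2 := ⟨j - 2, by omega⟩
    rw [hN']
    simp only [coeff_sub, coeff_add, coeff_C_mul, coeff_X_mul, coeff_X_add_C_pow]
    rw [hE (i + 2) (by omega), natDegree_le_iff_coeff_eq_zero.mp hSdeg i (by omega)]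
    rcases lt_trichotomy i n with h | rfl | h
    · obtain rfl : n = i + 1 := by omega
      rw [coeff_pred_eulerPoly, coeff_self_eulerPoly, show i + 1 + 2 - (i + 2) = 1 by omega,
        show i + 1 + 2 = (i + 2) + 1 by rfl, Nat.choose_succ_self_right]
      push_cast
      ring
    · rw [coeff_self_eulerPoly, hE (i + 1) (by omega)]
      simp
    · rw [hE i h, hE (i + 1) (by omega), Nat.choose_eq_zero_of_lt (by omega)]
      simp
  refine eq_zero_of_natDegree_lt_card_of_eval_eq_zero' N
    (insert 0 (eulerPoly n).roots.toFinset) ?_ ?_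
  · intro y hy
    rcases Finset.mem_insert.mp hy with rfl | hy
    · exact hzero
    · rw [Multiset.mem_toFinset, mem_roots (eulerPoly_ne_zero n)] at hy
      exact hroot y hy
  · rw [Finset.card_insert_of_notMem]
    · have := le_card_roots_eulerPoly n
      omega
    · rw [Multiset.mem_toFinset, mem_roots (eulerPoly_ne_zero n)]
      exact fun h => root_eulerPoly_ne_zero h rfl

end EulerFrobeniusRoots

section ExponentialSeries

open PowerSeries

/-- The power series `X^(n+1) (d/dX)^n (1 / (1 - exp X))`. -/
noncomputable def logisticSeries (n : ℕ) : PowerSeries ℝ :=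
  mk fun j => -((bernoulli j : ℝ) / (j.factorial : ℝ)) *
    ∏ i ∈ Finset.range n, ((j : ℝ) - ((i : ℝ) + 1))

theorem logisticSeries_succ (n : ℕ) :
    logisticSeries (n + 1) =
      X * derivative ℝ (logisticSeries n) - ((n : PowerSeries ℝ) + 1) * logisticSeries n := by
  have hc : ((n : PowerSeries ℝ) + 1) = C ((n : ℝ) + 1) := by simp
  ext j
  rw [hc, map_sub, coeff_C_mul]
  rcases j with _ | j
  · simp [logisticSeries, Finset.prod_range_succ]
    ring
  · rw [coeff_succ_X_mul, coeff_derivative]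
    simp only [logisticSeries, coeff_mk, Finset.prod_range_succ]
    push_cast
    ring

theorem logisticSeries_zero_mul : logisticSeries 0 * (1 - exp ℝ) = X := by
  have h : logisticSeries 0 = -bernoulliPowerSeries ℝ := by
    ext j
    simp [logisticSeries, bernoulliPowerSeries]
  rw [h, ← bernoulliPowerSeries_mul_exp_sub_one ℝ]
  ring

theorem X_pow_mul_aeval_eulerPoly (n : ℕ) :
    X ^ (n + 2) * (exp ℝ * Polynomial.aeval (exp ℝ) (eulerPoly n)) =
      (1 - exp ℝ) ^ (n + 2) * logisticSeries (n + 1) := by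
  induction n with
  | zero =>
    have h := logisticSeries_zero_mul
    have hd := congrArg (derivative ℝ) h
    simp only [Derivation.leibniz, map_sub, Derivation.map_one_eq_zero, derivative_exp,
      smul_eq_mul, derivative_X] at hd
    rw [logisticSeries_succ, eulerPoly_zero]
    simp only [map_one, Nat.cast_zero]
    linear_combination (-(1 - exp ℝ) * X) * hd + ((1 - exp ℝ) - X * exp ℝ) * h
  | succ n ih =>
    have hd := congrArg (derivative ℝ) ih
    simp only [Derivation.leibniz, Derivation.leibniz_pow, map_sub, Derivation.map_one_eq_zero,
      derivative_exp, smul_eq_mul, derivative_X, Derivation.map_aeval, nsmul_eq_mul] at hd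
    rw [logisticSeries_succ (n + 1), eulerPoly_succ]
    simp only [map_add, map_mul, map_sub, map_one, Polynomial.aeval_X,
      map_natCast]
    simp only [show n + 2 - 1 = n + 1 by rfl] at hd
    push_cast at hd ⊢
    linear_combination X * (1 - exp ℝ) * hd + ((n : PowerSeries ℝ) + 2) * (X * exp ℝ - (1 - exp ℝ)) * ih

/-- The power series `∑ l^n exp (n X) = 1 / (1 - l exp X)`. -/
noncomputable def geomExp (l : ℝ) : PowerSeries ℝ :=
  mk fun k => ∑' n : ℕ, l ^ n * coeff k (rescale (n : ℝ) (exp ℝ))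

theorem coeff_rescale_exp (a : ℝ) (k : ℕ) :
    coeff k (rescale a (exp ℝ)) = a ^ k / (k.factorial : ℝ) := by
  simp [coeff_rescale, coeff_exp, div_eq_mul_inv]

theorem hasSum_coeff_geomExp {l : ℝ} (hl : |l| < 1) (k : ℕ) :
    HasSum (fun n : ℕ => l ^ n * coeff k (rescale (n : ℝ) (exp ℝ))) (coeff k (geomExp l)) := by
  rw [geomExp, coeff_mk]
  refine Summable.hasSum ?_
  have h := (summable_pow_mul_geometric_of_norm_lt_one k
    (show ‖l‖ < 1 from hl)).mul_right ((k.factorial : ℝ)⁻¹)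
  refine h.congr fun n => ?_
  rw [coeff_rescale_exp]
  ring

theorem one_sub_mul_geomExp {l : ℝ} (hl : |l| < 1) :
    (1 - C l * exp ℝ) * geomExp l = 1 := by
  ext k
  have h1 : HasSum (fun n : ℕ => l ^ n * coeff k (rescale ((n + 1 : ℕ) : ℝ) (exp ℝ)))
      (coeff k (exp ℝ * geomExp l)) := by
    rw [coeff_mul]
    have := hasSum_sum (s := Finset.HasAntidiagonal.antidiagonal k) fun p _ =>
      (hasSum_coeff_geomExp hl p.2).mul_left (coeff p.1 (exp ℝ))
    refine this.congr_fun fun n => ?_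
    have he : rescale ((n + 1 : ℕ) : ℝ) (exp ℝ) = exp ℝ * rescale (n : ℝ) (exp ℝ) := by
      have := exp_mul_exp_eq_exp_add (A := ℝ) 1 (n : ℝ)
      simp only [rescale_one, RingHom.id_apply] at this
      rw [this]
      push_cast
      rw [add_comm]
    rw [he, coeff_mul, Finset.mul_sum]
    exact Finset.sum_congr rfl fun p _ => by ring
  have h2 := (hasSum_nat_add_iff' 1).mpr (hasSum_coeff_geomExp hl k)
  have h3 := h1.mul_left l
  have h4 := h3.unique (h2.congr_fun fun n => by rw [pow_succ]; ring)
  rw [sub_mul, one_mul, map_sub, mul_assoc, coeff_C_mul, h4]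
  rcases k with _ | k <;> simp [coeff_one]

/-- The power series `∑ l^|β| exp (β X)` over the integers. -/
noncomputable def bilateralGeomExp (l : ℝ) : PowerSeries ℝ :=
  geomExp l + evalNegHom (geomExp l) - 1

theorem hasSum_coeff_bilateralGeomExp {l : ℝ} (hl : |l| < 1) (k : ℕ) :
    HasSum (fun β : ℤ => l ^ β.natAbs * coeff k (rescale (β : ℝ) (exp ℝ)))
      (coeff k (bilateralGeomExp l)) := by
  have h := HasSum.of_nat_of_neg
    (f := fun β : ℤ => l ^ β.natAbs * coeff k (rescale (β : ℝ) (exp ℝ)))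
    (g := coeff k (geomExp l)) (g' := coeff k (evalNegHom (geomExp l)))
    (by simpa using hasSum_coeff_geomExp hl k)
    (by
      have := (hasSum_coeff_geomExp hl k).mul_left ((-1) ^ k)
      rw [evalNegHom, coeff_rescale]
      refine this.congr_fun fun n => ?_
      simp only [coeff_rescale_exp, Int.natAbs_neg, Int.natAbs_natCast, Int.cast_neg,
        Int.cast_natCast]
      rw [neg_pow (n : ℝ)]
      ring)
  rw [bilateralGeomExp, map_sub, map_add]
  have e : coeff k (1 : PowerSeries ℝ) =
      l ^ Int.natAbs 0 * coeff k (rescale ((0 : ℤ) : ℝ) (exp ℝ)) := by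
    rcases k with _ | k <;> simp [coeff_one]
  rw [e]
  exact h

theorem bilateralGeomExp_mul {l : ℝ} (hl : |l| < 1) (h0 : l ≠ 0) :
    bilateralGeomExp l * ((exp ℝ - C l) * (exp ℝ - C l⁻¹)) = exp ℝ * C (l - l⁻¹) := by
  have h1 := one_sub_mul_geomExp hl
  have h2 := congrArg evalNegHom h1
  have h3 : exp ℝ * evalNegHom (exp ℝ) = 1 := exp_mul_exp_neg_eq_one
  have hC : evalNegHom (C l) = C l := by
    ext n
    rcases n with _ | n <;> simp [evalNegHom, coeff_rescale, coeff_C]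
  simp only [map_mul, map_sub, map_one, hC] at h2
  have h4 : (C l : PowerSeries ℝ) * C l⁻¹ = 1 := by
    rw [← map_mul, mul_inv_cancel₀ h0, map_one]
  rw [bilateralGeomExp, map_sub]
  generalize geomExp l = g at *
  generalize evalNegHom g = g' at *
  generalize evalNegHom (exp ℝ) = e' at *
  generalize exp ℝ = e at *
  generalize (C l : PowerSeries ℝ) = c at *
  generalize (C l⁻¹ : PowerSeries ℝ) = d at *
  have h5 : (e - c) * g' = e := by linear_combination e * h2 + c * g' * h3
  have h6 : (e - d) * g = -d := by linear_combination (-d) * h1 - e * g * h4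
  linear_combination (e - c) * h6 + (e - d) * h5

end ExponentialSeries

section Symbol

open PowerSeries

/-- The coefficient of `l^|β|` in the discrete operator. -/
noncomputable def rootWeight (n : ℕ) (l : ℝ) : ℝ :=
  (1 - l) ^ (n + 3) / (l * (eulerPoly (n + 1)).eval l)

/-- The power series `∑ S(β) exp (β X)`, where `S` is the unscaled discrete operator. -/
noncomputable def symbolSeries (n : ℕ) : PowerSeries ℝ :=
  exp ℝ + evalNegHom (exp ℝ) - C (2 ^ (n + 1)) +
    ∑ l ∈ unitDiskRoots n, C (rootWeight n l) * bilateralGeomExp l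

theorem rootWeight_mul (n : ℕ) {l : ℝ} (hl : l ∈ unitDiskRoots n) :
    rootWeight n l * (l - l⁻¹) = pairWeight n l := by
  have h0 := root_eulerPoly_ne_zero (mem_unitDiskRoots.mp hl).1
  rw [rootWeight, pairWeight]
  field_simp

theorem aeval_eulerPoly_eq {n : ℕ} {l : ℝ} (hl : l ∈ unitDiskRoots n) :
    Polynomial.aeval (exp ℝ) (eulerPoly n) = (exp ℝ - C l) * (exp ℝ - C l⁻¹) *
      Polynomial.aeval (exp ℝ) (pairQuotient n l) := by
  conv_lhs => rw [eulerPoly_eq_mul_pairQuotient hl]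
  simp only [map_mul, map_sub, Polynomial.aeval_X, Polynomial.aeval_C]
  rfl

theorem symbolSeries_mul {n : ℕ} (hn : Even n) (hn2 : 2 ≤ n) :
    symbolSeries n * (exp ℝ * Polynomial.aeval (exp ℝ) (eulerPoly n)) =
      (1 - exp ℝ) ^ (n + 2) := by
  have hpf := congrArg (Polynomial.aeval (exp ℝ)) (one_sub_pow_eq_partial_fractions hn hn2)
  have hC (a : ℝ) : Polynomial.aeval (exp ℝ) (Polynomial.C a) = (C a : PowerSeries ℝ) :=
    Polynomial.aeval_C _ _
  simp only [map_mul, map_sub, map_add, map_pow, map_one, Polynomial.aeval_X, map_sum, hC] at hpf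
  have h3 : exp ℝ * evalNegHom (exp ℝ) = 1 := exp_mul_exp_neg_eq_one
  have hsum : (∑ l ∈ unitDiskRoots n, C (rootWeight n l) * bilateralGeomExp l) *
      Polynomial.aeval (exp ℝ) (eulerPoly n) = exp ℝ * ∑ l ∈ unitDiskRoots n,
        C (pairWeight n l) * Polynomial.aeval (exp ℝ) (pairQuotient n l) := by
    rw [Finset.sum_mul, Finset.mul_sum]
    refine Finset.sum_congr rfl fun l hl => ?_
    have hm := mem_unitDiskRoots.mp hl
    have hb := bilateralGeomExp_mul hm.2 (root_eulerPoly_ne_zero hm.1)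
    rw [aeval_eulerPoly_eq hl, ← rootWeight_mul n hl, map_mul]
    linear_combination (C (rootWeight n l) *
      Polynomial.aeval (exp ℝ) (pairQuotient n l)) * hb
  rw [hpf, symbolSeries]
  simp only [map_pow]
  linear_combination exp ℝ * hsum + Polynomial.aeval (exp ℝ) (eulerPoly n) * h3

theorem one_sub_exp_ne_zero : (1 - exp ℝ : PowerSeries ℝ) ≠ 0 := by
  intro h
  have := congrArg (coeff 1) h
  simp [coeff_exp, coeff_one] at this

theorem symbolSeries_mul_logisticSeries {n : ℕ} (hn : Even n) (hn2 : 2 ≤ n) :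
    symbolSeries n * logisticSeries (n + 1) = X ^ (n + 2) := by
  apply mul_left_cancel₀ (pow_ne_zero (n + 2) one_sub_exp_ne_zero)
  linear_combination (-symbolSeries n) * X_pow_mul_aeval_eulerPoly n
    + X ^ (n + 2) * symbolSeries_mul hn hn2

theorem coeff_of_mul_eq_X_pow {N : ℕ} (hN : 0 < N) {F H : PowerSeries ℝ} (hFH : F * H = X ^ N)
    (h0 : coeff 0 H ≠ 0) (hz : ∀ j, 0 < j → j < N → coeff j H = 0) :
    (∀ k, N < k → k < 2 * N → coeff k F = 0) ∧
      coeff (2 * N) F = -coeff N H / coeff 0 H ^ 2 := by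
  obtain ⟨L, hL⟩ : X ^ N ∣ H - C (coeff 0 H) := by
    rw [X_pow_dvd_iff]
    intro j hj
    rcases j with _ | j
    · simp
    · simp [hz (j + 1) (Nat.succ_pos j) hj]
  set a := coeff 0 H
  have hH : H = C a + X ^ N * L := by rw [← hL]; ring
  have hinv : H * H⁻¹ = 1 := PowerSeries.mul_inv_cancel H (by rwa [← coeff_zero_eq_constantCoeff_apply])
  have hF : F = X ^ N * H⁻¹ := by rw [← hFH, mul_assoc, hinv, mul_one]
  have hG : C a * H⁻¹ + X ^ N * (L * H⁻¹) = 1 := by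
    rw [← hinv]
    nth_rewrite 3 [hH]
    ring
  have hcoef (j : ℕ) (hj : j < N) : a * coeff j H⁻¹ = coeff j (1 : PowerSeries ℝ) := by
    rw [← hG, map_add, coeff_C_mul, coeff_X_pow_mul', if_neg (by omega), add_zero]
  have hLN : coeff 0 L = coeff N H := by
    rw [hH, map_add, coeff_X_pow_mul', if_pos le_rfl, coeff_C, if_neg hN.ne', Nat.sub_self,
      zero_add]
  have hG0 : coeff 0 H⁻¹ = 1 / a := by
    have := hcoef 0 hN
    rw [eq_div_iff h0, mul_comm, this]
    simp
  have hLG : coeff 0 (L * H⁻¹) = coeff N H * (1 / a) := by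
    rw [← hLN, ← hG0]
    simp
  rw [hF]
  constructor
  · intro k hk hk2
    rw [coeff_X_pow_mul', if_pos hk.le]
    have := hcoef (k - N) (by omega)
    rw [coeff_one, if_neg (by omega)] at this
    exact (mul_eq_zero.mp this).resolve_left h0
  · rw [coeff_X_pow_mul', if_pos (by omega), show 2 * N - N = N by omega]
    have := congrArg (coeff N) hG
    rw [map_add, coeff_C_mul, coeff_X_pow_mul', if_pos le_rfl, Nat.sub_self, hLG, coeff_one, if_neg hN.ne'] at this
    field_simp
    field_simp at this
    linarith

theorem coeff_zero_logisticSeries {n : ℕ} (hn : Odd n) :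
    coeff 0 (logisticSeries n) = (n.factorial : ℝ) := by
  have h : ∀ n : ℕ, ∏ i ∈ Finset.range n, ((0 : ℝ) - ((i : ℝ) + 1)) = (-1) ^ n * n.factorial := by
    intro n
    induction n with
    | zero => simp
    | succ n ih =>
      rw [Finset.prod_range_succ, ih, Nat.factorial_succ]
      push_cast
      ring
  simp only [logisticSeries, coeff_mk, Nat.cast_zero, h, hn.neg_one_pow]
  simp

theorem coeff_logisticSeries_eq_zero {n j : ℕ} (hj : 0 < j) (hjn : j ≤ n) :
    coeff j (logisticSeries n) = 0 := by
  rw [logisticSeries, coeff_mk, Finset.prod_eq_zero (Finset.mem_range.mpr (show j - 1 < n by omega)),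
    mul_zero]
  rw [Nat.cast_sub (by omega)]
  simp

theorem coeff_succ_logisticSeries (n : ℕ) :
    coeff (n + 1) (logisticSeries n) =
      -((bernoulli (n + 1) : ℝ) / ((n + 1).factorial : ℝ)) * (n.factorial : ℝ) := by
  have h : ∏ i ∈ Finset.range n, (((n + 1 : ℕ) : ℝ) - ((i : ℝ) + 1)) = n.factorial := by
    rw [← Finset.prod_range_add_one_eq_factorial, ← Finset.prod_range_reflect, Nat.cast_prod]
    refine Finset.prod_congr rfl fun i hi => ?_
    have := Finset.mem_range.mp hi
    rw [show n - 1 - i = n - (i + 1) by omega, Nat.cast_add, Nat.cast_one, Nat.cast_add,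
      Nat.cast_sub (by omega)]
    push_cast
    ring
  rw [logisticSeries, coeff_mk, h]

theorem coeff_symbolSeries {n : ℕ} (hn : Even n) (hn2 : 2 ≤ n) :
    (∀ k, n + 2 < k → k < 2 * (n + 2) → coeff k (symbolSeries n) = 0) ∧
      coeff (2 * (n + 2)) (symbolSeries n) =
        (bernoulli (n + 2) : ℝ) / (((n + 2).factorial : ℝ) * ((n + 1).factorial : ℝ)) := by
  have hf : ((n + 1).factorial : ℝ) ≠ 0 := Nat.cast_ne_zero.mpr (Nat.factorial_ne_zero _)
  have h0 := coeff_zero_logisticSeries hn.add_one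
  obtain ⟨h1, h2⟩ := coeff_of_mul_eq_X_pow (Nat.succ_pos (n + 1))
    (symbolSeries_mul_logisticSeries hn hn2) (h0 ▸ hf)
    fun j hj hjn => coeff_logisticSeries_eq_zero hj (Nat.lt_succ_iff.mp hjn)
  refine ⟨h1, h2.trans ?_⟩
  rw [h0, coeff_succ_logisticSeries (n + 1)]
  have hf2 : ((n + 2).factorial : ℝ) ≠ 0 := Nat.cast_ne_zero.mpr (Nat.factorial_ne_zero _)
  field_simp

theorem hasSum_Dm {m : ℕ} (hm : 2 ≤ m) (h : ℝ) (k : ℕ) :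
    HasSum (fun β : ℤ => Dm m h β * (h * (β : ℝ)) ^ k)
      (((2 * m - 1).factorial : ℝ) / h ^ (2 * m) * (h ^ k * (k.factorial : ℝ)) *
        coeff k (symbolSeries (2 * m - 2))) := by
  obtain ⟨n, hn⟩ : ∃ n, n = 2 * m - 2 := ⟨_, rfl⟩
  rw [← hn]
  have e1 : 2 * m - 1 = n + 1 := by omega
  have e2 : 2 * m + 1 = n + 3 := by omega
  have hL : smallRoots m = unitDiskRoots n := by rw [smallRoots, unitDiskRoots, hn]
  have hk : (k.factorial : ℝ) ≠ 0 := Nat.cast_ne_zero.mpr (Nat.factorial_ne_zero _)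
  set c : ℤ → ℝ := fun β => coeff k (rescale (β : ℝ) (exp ℝ)) with hc
  have hdelta (a : ℤ) : HasSum (fun β : ℤ => if β = a then c β else 0) (c a) := by
    simpa using hasSum_single (f := fun β : ℤ => if β = a then c β else 0) a
      fun b hb => if_neg hb
  have hroots := hasSum_sum (s := unitDiskRoots n) fun l hl =>
    (hasSum_coeff_bilateralGeomExp (mem_unitDiskRoots.mp hl).2 k).mul_left (rootWeight n l)
  have htot := ((((hdelta 1).add (hdelta (-1))).sub ((hdelta 0).mul_left (2 ^ (n + 1)))).add
    hroots).mul_left (((2 * m - 1).factorial : ℝ) / h ^ (2 * m) * (h ^ k * (k.factorial : ℝ)))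
  have hval : coeff k (symbolSeries n) = c 1 + c (-1) - 2 ^ (n + 1) * c 0 +
      ∑ l ∈ unitDiskRoots n, rootWeight n l * coeff k (bilateralGeomExp l) := by
    have h0 : c 0 = coeff k (1 : PowerSeries ℝ) := by
      rcases k with _ | k <;> simp [hc, coeff_one]
    have hC : (C (2 ^ (n + 1)) : PowerSeries ℝ) = C (2 ^ (n + 1)) * 1 := by ring
    rw [symbolSeries, hC, h0]
    simp only [map_add, map_sub, map_sum, coeff_C_mul]
    simp [hc, evalNegHom]
  rw [hval]
  refine htot.congr_fun fun β => ?_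
  have hpow : (h * (β : ℝ)) ^ k = h ^ k * (k.factorial : ℝ) * c β := by
    rw [hc]
    simp only [coeff_rescale_exp]
    field_simp
    exact mul_pow _ _ _
  rw [Dm, hpow, hL, e1, e2]
  have hs : (if β = 0 then -(2 : ℝ) ^ (n + 1) + ∑ l ∈ unitDiskRoots n,
        (1 - l) ^ (n + 3) / (l * (eulerPoly (n + 1)).eval l)
      else if β.natAbs = 1 then
        1 + ∑ l ∈ unitDiskRoots n, (1 - l) ^ (n + 3) / (eulerPoly (n + 1)).eval l
      else ∑ l ∈ unitDiskRoots n,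
        (1 - l) ^ (n + 3) * l ^ β.natAbs / (l * (eulerPoly (n + 1)).eval l)) =
      (if β = 1 then 1 else 0) + (if β = -1 then 1 else 0)
        - 2 ^ (n + 1) * (if β = 0 then 1 else 0)
        + ∑ l ∈ unitDiskRoots n, rootWeight n l * l ^ β.natAbs := by
    have hgen (j : ℕ) : ∑ l ∈ unitDiskRoots n,
        (1 - l) ^ (n + 3) * l ^ j / (l * (eulerPoly (n + 1)).eval l) =
        ∑ l ∈ unitDiskRoots n, rootWeight n l * l ^ j :=
      Finset.sum_congr rfl fun l _ => by rw [rootWeight]; ring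
    have hone : ∑ l ∈ unitDiskRoots n, (1 - l) ^ (n + 3) / (eulerPoly (n + 1)).eval l =
        ∑ l ∈ unitDiskRoots n, rootWeight n l * l ^ 1 :=
      Finset.sum_congr rfl fun l hl => by
        have h0 := root_eulerPoly_ne_zero (mem_unitDiskRoots.mp hl).1
        rw [rootWeight]
        field_simp
    rcases eq_or_ne β 0 with rfl | hβ0
    · simp [rootWeight]
    · rw [if_neg hβ0]
      rcases eq_or_ne β 1 with rfl | hβ1
      · simp [hone]
      · rcases eq_or_ne β (-1) with rfl | hβ2
        · simp [hone]
        · rw [if_neg (by omega), hgen]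
          simp [hβ0, hβ1, hβ2]
  rw [hs]
  have hsplit : (((if β = 1 then c β else 0) + (if β = -1 then c β else 0)
        - 2 ^ (n + 1) * (if β = 0 then c β else 0))
        + ∑ l ∈ unitDiskRoots n, rootWeight n l * (l ^ β.natAbs * c β)) =
      ((if β = 1 then 1 else 0) + (if β = -1 then 1 else 0)
        - 2 ^ (n + 1) * (if β = 0 then 1 else 0)
        + ∑ l ∈ unitDiskRoots n, rootWeight n l * l ^ β.natAbs) * c β := by
    rw [add_mul, Finset.sum_mul]
    congr 1
    · split_ifs <;> ring
    · exact Finset.sum_congr rfl fun l _ => by ring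
  change _ = _ * (((if β = 1 then c β else 0) + (if β = -1 then c β else 0)
        - 2 ^ (n + 1) * (if β = 0 then c β else 0))
        + ∑ l ∈ unitDiskRoots n, rootWeight n l * (l ^ β.natAbs * c β))
  rw [hsplit]
  ring

end Symbol

theorem Dm_mul_monomial_sum_high (m : ℕ) (hm : 2 ≤ m) (h : ℝ) (hh : 0 < h)
    (k : ℕ) (hk1 : 2 * m + 1 ≤ k) (hk2 : k ≤ 4 * m) :
    Summable (fun β : ℤ => Dm m h β * (h * (β : ℝ)) ^ k) ∧
    (k ≤ 4 * m - 1 → ∑' β : ℤ, Dm m h β * (h * (β : ℝ)) ^ k = 0) ∧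
    (k = 4 * m → ∑' β : ℤ, Dm m h β * (h * (β : ℝ)) ^ k =
      h ^ (2 * m) * ((4 * m).factorial : ℝ) * ((bernoulli (2 * m) : ℚ) : ℝ) /
        ((2 * m).factorial : ℝ)) := by
  have hs := hasSum_Dm hm h k
  have heven : Even (2 * m - 2) := ⟨m - 1, by omega⟩
  obtain ⟨hz, htop⟩ := coeff_symbolSeries heven (by omega)
  refine ⟨hs.summable, fun hk => ?_, ?_⟩
  · rw [hs.tsum_eq, hz k (by omega) (by omega), mul_zero]
  · rintro rfl
    rw [show 2 * (2 * m - 2 + 2) = 4 * m by omega, show 2 * m - 2 + 2 = 2 * m by omega,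
      show 2 * m - 2 + 1 = 2 * m - 1 by omega] at htop
    rw [hs.tsum_eq, htop, show 4 * m = 2 * m + 2 * m by ring, pow_add]
    have hf1 : ((2 * m - 1).factorial : ℝ) ≠ 0 := Nat.cast_ne_zero.mpr (Nat.factorial_ne_zero _)
    have hf2 : ((2 * m).factorial : ℝ) ≠ 0 := Nat.cast_ne_zero.mpr (Nat.factorial_ne_zero _)
    have hh0 : h ≠ 0 := hh.ne'
    field_simp
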